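/- Suppose 0 < 1/m ≪ 1/k ≤ ε ≪ ρ, 1/ℓ ≤ 1, ρ ≪ 1, 0 ≤ μ ≤ 1/4, and let G' be a bipartite digraph from V_i to V_{i+1} (each of size m) in which every vertex of V_i has outdegree (1−μ±√ε)m and every vertex of V_{i+1} has indegree (1−μ±√ε)m. Then for any integer s₀ ≤ ℓm/k, G' contains at least (1−μ−ρ)m − s₀ pairwise edge-disjoint perfect matchings. -/

import Mathlib

open Finset

/-- Outdegree of a vertex in a digraph given as a finite set of ordered pairs. -/
def outdegD {V : Type*} [DecidableEq V] (G : Finset (V × V)) (v : V) : ℕ :=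
  (G.filter fun e => e.1 = v).card

/-- Indegree of a vertex. -/
def indegD {V : Type*} [DecidableEq V] (G : Finset (V × V)) (v : V) : ℕ :=
  (G.filter fun e => e.2 = v).card

/-- Edges from `S` to `T`. -/
def eBetw {V : Type*} [DecidableEq V] (G : Finset (V × V)) (S T : Finset V) : ℕ :=
  (G.filter fun e => e.1 ∈ S ∧ e.2 ∈ T).card

lemma sum_outdegD {V : Type*} [DecidableEq V] (G : Finset (V × V)) (S : Finset V) :
    ∑ u ∈ S, outdegD G u = (G.filter fun e => e.1 ∈ S).card := by
  rw [Finset.card_eq_sum_card_fiberwise (f := Prod.fst) (t := S)]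
  · apply Finset.sum_congr rfl
    intro u hu
    unfold outdegD
    congr 1
    ext e
    simp only [mem_filter]
    constructor
    · rintro ⟨h, rfl⟩; exact ⟨⟨h, hu⟩, rfl⟩
    · rintro ⟨⟨h, _⟩, h2⟩; exact ⟨h, h2⟩
  · intro e he
    simpa using (Finset.mem_filter.mp (Finset.mem_coe.mp he)).2

lemma sum_indegD {V : Type*} [DecidableEq V] (G : Finset (V × V)) (S : Finset V) :
    ∑ u ∈ S, indegD G u = (G.filter fun e => e.2 ∈ S).card := by
  rw [Finset.card_eq_sum_card_fiberwise (f := Prod.snd) (t := S)]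
  · apply Finset.sum_congr rfl
    intro u hu
    unfold indegD
    congr 1
    ext e
    simp only [mem_filter]
    constructor
    · rintro ⟨h, rfl⟩; exact ⟨⟨h, hu⟩, rfl⟩
    · rintro ⟨⟨h, _⟩, h2⟩; exact ⟨h, h2⟩
  · intro e he
    simpa using (Finset.mem_filter.mp (Finset.mem_coe.mp he)).2

lemma out_split {V : Type*} [DecidableEq V] (U W : Finset V) (G : Finset (V × V))
    (hG : ∀ e ∈ G, e.1 ∈ U ∧ e.2 ∈ W) (S T : Finset V) :
    ∑ u ∈ S, outdegD G u = eBetw G S T + eBetw G S (W \ T) := by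
  rw [sum_outdegD]
  unfold eBetw
  rw [← Finset.card_union_of_disjoint]
  · congr 1
    ext e
    simp only [mem_filter, mem_union, mem_sdiff]
    have := hG e
    tauto
  · rw [Finset.disjoint_left]
    intro e
    simp only [mem_filter, mem_sdiff]
    tauto

lemma in_split {V : Type*} [DecidableEq V] (U W : Finset V) (G : Finset (V × V))
    (hG : ∀ e ∈ G, e.1 ∈ U ∧ e.2 ∈ W) (S T : Finset V) :
    ∑ w ∈ T, indegD G w = eBetw G S T + eBetw G (U \ S) T := by
  rw [sum_indegD]
  unfold eBetw
  rw [← Finset.card_union_of_disjoint]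
  · congr 1
    ext e
    simp only [mem_filter, mem_union, mem_sdiff]
    have := hG e
    tauto
  · rw [Finset.disjoint_left]
    intro e
    simp only [mem_filter, mem_sdiff]
    tauto

lemma eBetw_le_mul {V : Type*} [DecidableEq V] (G : Finset (V × V)) (S T : Finset V) :
    eBetw G S T ≤ S.card * T.card := by
  rw [← Finset.card_product]
  apply Finset.card_le_card
  intro e he
  simp only [mem_filter] at he
  exact Finset.mem_product.mpr he.2

lemma eBetw_le_in {V : Type*} [DecidableEq V] (G : Finset (V × V)) (S T : Finset V) :
    eBetw G S T ≤ ∑ w ∈ T, indegD G w := by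
  rw [sum_indegD]
  apply Finset.card_le_card
  intro e he
  simp only [mem_filter] at he ⊢
  exact ⟨he.1, he.2.2⟩

lemma outdegD_sdiff {V : Type*} [DecidableEq V] (G F : Finset (V × V)) (h : F ⊆ G) (u : V) :
    outdegD (G \ F) u + outdegD F u = outdegD G u := by
  unfold outdegD
  rw [← Finset.card_union_of_disjoint]
  · congr 1
    ext e
    simp only [mem_filter, mem_union, mem_sdiff]
    have := @h e
    tauto
  · rw [Finset.disjoint_left]
    intro e
    simp only [mem_filter, mem_sdiff]
    tauto

lemma indegD_sdiff {V : Type*} [DecidableEq V] (G F : Finset (V × V)) (h : F ⊆ G) (u : V) :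
    indegD (G \ F) u + indegD F u = indegD G u := by
  unfold indegD
  rw [← Finset.card_union_of_disjoint]
  · congr 1
    ext e
    simp only [mem_filter, mem_union, mem_sdiff]
    have := @h e
    tauto
  · rw [Finset.disjoint_left]
    intro e
    simp only [mem_filter, mem_sdiff]
    tauto

/-- Neighbourhoods in the gadget graph. -/
def gadN {V : Type*} [DecidableEq V] (G : Finset (V × V)) (r : ℕ) :
    (V × V) ⊕ (Σ _ : V, ℕ) → Finset ((V × V) ⊕ (Σ _ : V, ℕ))
  | Sum.inl e => ({e} : Finset (V × V)).disjSum
      (({e.1} : Finset V).sigma fun u => range (outdegD G u - r))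
  | Sum.inr p => (G.filter fun e => e.2 = p.1).disjSum ∅

lemma gad_hall {V : Type*} [DecidableEq V] (U W : Finset V) (G : Finset (V × V))
    (m r : ℕ) (hW : W.card = m)
    (hG : ∀ e ∈ G, e.1 ∈ U ∧ e.2 ∈ W)
    (hout : ∀ u ∈ U, r ≤ outdegD G u) (hin : ∀ w ∈ W, r ≤ indegD G w)
    (hS : ∀ S ⊆ U, ∀ T ⊆ W, r * (S.card + T.card) ≤ eBetw G S T + r * m)
    (X : Finset ((V × V) ⊕ (Σ _ : V, ℕ)))
    (hX : X ⊆ G.disjSum (W.sigma fun w => range (indegD G w - r))) :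
    X.card ≤ (X.biUnion (gadN G r)).card := by
  classical
  set E1 := G.filter fun e => Sum.inl e ∈ X with hE1
  set T := W.filter fun w => ∃ i, Sum.inr ⟨w, i⟩ ∈ X with hT
  set S := E1.image Prod.fst with hSdef
  have hSU : S ⊆ U := by
    intro u hu
    obtain ⟨e, he, rfl⟩ := Finset.mem_image.mp hu
    exact (hG e (Finset.mem_filter.mp he).1).1
  have hTW : T ⊆ W := Finset.filter_subset _ _
  have h1 : X ⊆ E1.disjSum (T.sigma fun w => range (indegD G w - r)) := by
    intro x hx
    have hx' := hX hx
    rcases x with e | ⟨w, i⟩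
    · simp only [inl_mem_disjSum] at hx' ⊢
      exact Finset.mem_filter.mpr ⟨hx', hx⟩
    · simp only [inr_mem_disjSum, mem_sigma] at hx' ⊢
      exact ⟨Finset.mem_filter.mpr ⟨hx'.1, i, hx⟩, hx'.2⟩
  have h2 : (E1 ∪ G.filter fun e => e.2 ∈ T).disjSum
      (S.sigma fun u => range (outdegD G u - r)) ⊆ X.biUnion (gadN G r) := by
    intro x hx
    rw [Finset.mem_biUnion]
    rcases x with e | ⟨u, i⟩
    · simp only [inl_mem_disjSum, mem_union] at hx
      rcases hx with hx | hx
      · exact ⟨_, (Finset.mem_filter.mp hx).2, by simp [gadN]⟩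
      · obtain ⟨heG, heT⟩ := Finset.mem_filter.mp hx
        obtain ⟨_, i, hi⟩ := Finset.mem_filter.mp heT
        exact ⟨_, hi, by simp [gadN, heG]⟩
    · simp only [inr_mem_disjSum, mem_sigma] at hx
      obtain ⟨hu, hi⟩ := hx
      obtain ⟨e, he, rfl⟩ := Finset.mem_image.mp hu
      exact ⟨_, (Finset.mem_filter.mp he).2, by simpa [gadN] using hi⟩
  have c1 := Finset.card_le_card h1
  have c2 := Finset.card_le_card h2
  rw [Finset.card_disjSum, Finset.card_sigma] at c1 c2
  simp only [Finset.card_range] at c1 c2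
  have s1 : ∑ w ∈ T, (indegD G w - r) + r * T.card = ∑ w ∈ T, indegD G w := by
    rw [mul_comm, ← smul_eq_mul, ← Finset.sum_const, ← Finset.sum_add_distrib]
    exact Finset.sum_congr rfl fun w hw => Nat.sub_add_cancel (hin w (hTW hw))
  have s2 : ∑ w ∈ S, (outdegD G w - r) + r * S.card = ∑ w ∈ S, outdegD G w := by
    rw [mul_comm, ← smul_eq_mul, ← Finset.sum_const, ← Finset.sum_add_distrib]
    exact Finset.sum_congr rfl fun w hw => Nat.sub_add_cancel (hout w (hSU hw))
  have s3 := out_split U W G hG S T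
  have s4 := hS S hSU (W \ T) Finset.sdiff_subset
  have s5 : (W \ T).card + T.card = m := by
    rw [Finset.card_sdiff_add_card_eq_card hTW, hW]
  have s6 := sum_indegD G T
  have s7 := Finset.card_union_add_card_inter E1 (G.filter fun e => e.2 ∈ T)
  have s8 : (E1 ∩ G.filter fun e => e.2 ∈ T).card ≤ eBetw G S T := by
    apply Finset.card_le_card
    intro e he
    simp only [mem_inter, mem_filter] at he ⊢
    exact ⟨he.2.1, Finset.mem_image_of_mem _ (he.1), he.2.2⟩
  have s9 : r * S.card ≤ eBetw G S (W \ T) + r * T.card := by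
    rw [← s5] at s4
    nlinarith
  omega

lemma factor {V : Type*} [DecidableEq V] (U W : Finset V) (G : Finset (V × V))
    (m r : ℕ) (hU : U.card = m) (hW : W.card = m)
    (hG : ∀ e ∈ G, e.1 ∈ U ∧ e.2 ∈ W)
    (hS : ∀ S ⊆ U, ∀ T ⊆ W, r * (S.card + T.card) ≤ eBetw G S T + r * m) :
    ∃ F ⊆ G, (∀ u ∈ U, outdegD F u = r) ∧ (∀ w ∈ W, indegD F w = r) := by
  classical
  have hout : ∀ u ∈ U, r ≤ outdegD G u := by
    intro u hu
    have h := hS {u} (by simpa using hu) W subset_rfl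
    have h2 := out_split U W G hG {u} W
    rw [Finset.sum_singleton] at h2
    rw [Finset.card_singleton, hW] at h
    nlinarith
  have hin : ∀ u ∈ W, r ≤ indegD G u := by
    intro u hu
    have h := hS U subset_rfl {u} (by simpa using hu)
    have h2 := in_split U W G hG U {u}
    rw [Finset.sum_singleton] at h2
    rw [Finset.card_singleton, hU] at h
    nlinarith
  set L := G.disjSum (W.sigma fun w => range (indegD G w - r)) with hL
  obtain ⟨f, hfi, hf⟩ := (Finset.all_card_le_biUnion_card_iff_exists_injective
    (fun x : L => gadN G r x.1)).mp (by
      intro s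
      have h := gad_hall U W G m r hW hG hout hin hS (s.map (Function.Embedding.subtype _))
        (by intro x hx; obtain ⟨y, _, rfl⟩ := Finset.mem_map.mp hx; exact y.2)
      rw [Finset.card_map] at h
      refine h.trans (Finset.card_le_card ?_)
      intro x hx
      simp only [mem_biUnion, mem_map] at hx ⊢
      obtain ⟨a, ⟨b, hb, rfl⟩, hx⟩ := hx
      exact ⟨b, hb, hx⟩)
  let g : (V × V) ⊕ (Σ _ : V, ℕ) → (V × V) ⊕ (Σ _ : V, ℕ) := fun x =>
    if h : x ∈ L then f ⟨x, h⟩ else x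
  have hg : ∀ x ∈ L, g x ∈ gadN G r x := by
    intro x hx
    simp only [g, dif_pos hx]
    exact hf ⟨x, hx⟩
  have hgi : ∀ x ∈ L, ∀ y ∈ L, g x = g y → x = y := by
    intro x hx y hy hxy
    simp only [g, dif_pos hx, dif_pos hy] at hxy
    exact congrArg Subtype.val (hfi hxy)
  have hLl : ∀ e ∈ G, Sum.inl e ∈ L := fun e he => by simpa [hL] using he
  set F := G.filter fun e => g (Sum.inl e) = Sum.inl e with hF
  have hFG : F ⊆ G := Finset.filter_subset _ _
  have ho : ∀ u ∈ U, r ≤ outdegD F u := by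
    intro u hu
    have h1 := outdegD_sdiff G F hFG u
    have h2 : outdegD (G \ F) u ≤ outdegD G u - r := by
      have : (((({u} : Finset V).sigma fun u => range (outdegD G u - r))).map
          (Function.Embedding.inr : (Σ _ : V, ℕ) ↪ (V × V) ⊕ (Σ _ : V, ℕ))).card
          = outdegD G u - r := by
        rw [Finset.card_map, Finset.card_sigma]; simp
      rw [← this]
      unfold outdegD
      apply Finset.card_le_card_of_injOn (fun e => g (Sum.inl e))
      · intro e he
        have he := Finset.mem_coe.mp he
        simp only [mem_filter, mem_sdiff, hF, not_and] at he
        obtain ⟨⟨heG, hne⟩, rfl⟩ := he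
        have hn := hne heG
        have hm := hg _ (hLl e heG)
        simp only [gadN, mem_disjSum] at hm
        rcases hm with ⟨a, ha, hae⟩ | ⟨a, ha, hae⟩
        · rw [Finset.mem_singleton] at ha
          exact absurd (by rw [← hae, ha]) hn
        · apply Finset.mem_coe.mpr
          rw [Finset.mem_map]
          exact ⟨a, ha, hae⟩
      · intro e he e' he' h
        have he := Finset.mem_coe.mp he
        have he' := Finset.mem_coe.mp he'
        simp only [mem_filter, mem_sdiff] at he he'
        exact Sum.inl_injective (hgi _ (hLl e he.1.1) _ (hLl e' he'.1.1) h)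
    have := hout u hu
    omega
  have hi : ∀ w ∈ W, indegD F w ≤ r := by
    intro w hw
    have h1 := indegD_sdiff G F hFG w
    have h2 : indegD G w - r ≤ indegD (G \ F) w := by
      have hLr : ∀ i ∈ range (indegD G w - r), Sum.inr ⟨w, i⟩ ∈ L := by
        intro i hi
        simp only [hL, inr_mem_disjSum, mem_sigma]
        exact ⟨hw, hi⟩
      have : (((G \ F).filter fun e => e.2 = w).map
          (Function.Embedding.inl : (V × V) ↪ (V × V) ⊕ (Σ _ : V, ℕ))).card
          = indegD (G \ F) w := by
        rw [Finset.card_map]; rfl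
      rw [← this, ← Finset.card_range (indegD G w - r)]
      apply Finset.card_le_card_of_injOn (fun i => g (Sum.inr ⟨w, i⟩))
      · intro i hi
        have hi := Finset.mem_coe.mp hi
        have hm := hg _ (hLr i hi)
        simp only [gadN, mem_disjSum] at hm
        rcases hm with ⟨a, ha, hae⟩ | ⟨a, ha, hae⟩
        · apply Finset.mem_coe.mpr
          rw [Finset.mem_map]
          refine ⟨a, ?_, hae⟩
          obtain ⟨haG, haw⟩ := Finset.mem_filter.mp ha
          rw [Finset.mem_filter, Finset.mem_sdiff]
          refine ⟨⟨haG, fun haF => ?_⟩, haw⟩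
          have h3 := (Finset.mem_filter.mp haF).2
          have h4 := hgi _ (hLl a haG) _ (hLr i hi) (h3.trans hae)
          cases h4
        · simp at ha
      · intro i hi j hj h
        have := hgi _ (hLr i (Finset.mem_coe.mp hi)) _ (hLr j (Finset.mem_coe.mp hj)) h
        simpa using this
    have := hin w hw
    omega
  have hFU : ∑ u ∈ U, outdegD F u = F.card := by
    rw [sum_outdegD]
    congr 1
    exact Finset.filter_true_of_mem fun e he => (hG e (hFG he)).1
  have hFW : ∑ u ∈ W, indegD F u = F.card := by
    rw [sum_indegD]
    congr 1
    exact Finset.filter_true_of_mem fun e he => (hG e (hFG he)).2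
  have c1 : ∑ u ∈ U, r ≤ ∑ u ∈ U, outdegD F u := Finset.sum_le_sum ho
  have c2 : ∑ u ∈ W, indegD F u ≤ ∑ u ∈ W, r := Finset.sum_le_sum hi
  have c3 : ∑ u ∈ W, r = ∑ u ∈ U, r := by simp [hU, hW]
  refine ⟨F, hFG, ?_, ?_⟩
  · intro u hu
    exact ((Finset.sum_eq_sum_iff_of_le ho).mp (by omega) u hu).symm
  · intro w hw
    exact (Finset.sum_eq_sum_iff_of_le hi).mp (by omega) w hw

lemma decomp {V : Type*} [DecidableEq V] (U W : Finset V) (m : ℕ) (hU : U.card = m)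
    (hW : W.card = m) (r : ℕ) : ∀ (G : Finset (V × V)),
    (∀ e ∈ G, e.1 ∈ U ∧ e.2 ∈ W) → (∀ u ∈ U, outdegD G u = r) → (∀ w ∈ W, indegD G w = r) →
    ∃ F : Fin r → Finset (V × V), (∀ j, F j ⊆ G ∧
          (∀ u ∈ U, outdegD (F j) u = 1) ∧ (∀ w ∈ W, indegD (F j) w = 1)) ∧
        (∀ j j', j ≠ j' → Disjoint (F j) (F j')) := by
  induction r with
  | zero => intro G _ _ _; exact ⟨fun _ => ∅, fun j => j.elim0, fun j => j.elim0⟩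
  | succ r ih =>
    intro G hG ho hi
    obtain ⟨M, hMG, hMo, hMi⟩ := factor U W G m 1 hU hW hG (by
      intro S hS T hT
      have h1 := out_split U W G hG S T
      have h2 := eBetw_le_in G S (W \ T)
      rw [Finset.sum_congr rfl fun u hu => ho u (hS hu)] at h1
      rw [Finset.sum_congr rfl fun u hu => hi u (Finset.mem_sdiff.mp hu).1] at h2
      simp only [Finset.sum_const, smul_eq_mul] at h1 h2
      have s5 : (W \ T).card + T.card = m := by
        rw [Finset.card_sdiff_add_card_eq_card hT, hW]
      by_cases hc : S.card ≤ (W \ T).card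
      · omega
      · obtain ⟨x, hx⟩ := Nat.exists_eq_add_of_le (not_le.mp hc).le
        rw [hx] at h1
        have : x ≤ x * (r + 1) := Nat.le_mul_of_pos_right _ (by omega)
        rw [add_mul] at h1
        omega)
    obtain ⟨F, hF, hd⟩ := ih (G \ M) (fun e he => hG e (Finset.mem_sdiff.mp he).1)
      (fun u hu => by
        have := outdegD_sdiff G M hMG u
        have := ho u hu
        have := hMo u hu
        omega)
      (fun u hu => by
        have := indegD_sdiff G M hMG u
        have := hi u hu
        have := hMi u hu
        omega)
    have hdM : ∀ j, Disjoint M (F j) := fun j =>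
      Finset.disjoint_of_subset_right (hF j).1 Finset.disjoint_sdiff
    refine ⟨Fin.cons M F, ?_, ?_⟩
    · intro j
      refine Fin.cases ?_ (fun j => ?_) j
      · exact ⟨hMG, hMo, hMi⟩
      · exact ⟨(hF j).1.trans Finset.sdiff_subset, (hF j).2⟩
    · intro j j'
      refine Fin.cases ?_ (fun j => ?_) j <;> refine Fin.cases ?_ (fun j' => ?_) j'
      · intro h; exact absurd rfl h
      · intro _; exact hdM j'
      · intro _; exact (hdM j).symm
      · intro h
        exact hd j j' fun h' => h (by rw [h'])

lemma key_ineq (m r δ Δ s t e : ℝ) (hr : 0 ≤ r) (hs : s ≤ m) (ht : t ≤ m)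
    (hs0 : 0 ≤ s) (ht0 : 0 ≤ t)
    (h1 : δ * s ≤ e + Δ * (m - t)) (h2 : δ * s ≤ e + s * (m - t))
    (h3 : δ * t ≤ e + t * (m - s)) (he : 0 ≤ e) (hδ : 2 * m ≤ 3 * δ) (hΔ : δ ≤ Δ)
    (hrδ : Δ - δ ≤ δ - r) : r * (s + t) ≤ e + r * m := by
  by_cases hx : s + t ≤ m
  · nlinarith
  push Not at hx
  by_cases hta : t ≤ δ
  · nlinarith [mul_nonneg (sub_nonneg.mpr hs) (sub_nonneg.mpr hta),
      mul_nonneg (by linarith : 0 ≤ δ - r) (by linarith : 0 ≤ s + t - m)]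
  by_cases hsa : s ≤ δ
  · nlinarith [mul_nonneg (sub_nonneg.mpr ht) (sub_nonneg.mpr hsa),
      mul_nonneg (by linarith : 0 ≤ δ - r) (by linarith : 0 ≤ s + t - m)]
  push Not at hta hsa
  nlinarith [mul_le_mul_of_nonneg_right hrδ (by linarith : 0 ≤ m - t),
    mul_nonneg (by linarith : 0 ≤ δ - r) (by linarith : 0 ≤ (s + t - m) - (m - t))]

/-- An almost-regular bipartite digraph from `V_i` to `V_{i+1}` with degrees `(1-μ±√ε)m`
contains at least `(1-μ-ρ)m - s₀` pairwise edge-disjoint perfect matchings. -/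
theorem stmt17 :
    ∃ ρ₀ : ℝ, 0 < ρ₀ ∧ ∀ ρ : ℝ, 0 < ρ → ρ ≤ ρ₀ →
    ∀ ℓ : ℕ, 1 ≤ ℓ →
    ∃ ε₀ : ℝ, 0 < ε₀ ∧ ∀ ε : ℝ, 0 < ε → ε ≤ ε₀ →
    ∀ k : ℕ, 0 < k → (1 : ℝ) / k ≤ ε →
    ∃ m₀ : ℕ, ∀ m : ℕ, m₀ ≤ m →
    ∀ μ : ℝ, 0 ≤ μ → μ ≤ 1/4 →
    ∀ (V : Type) [inst : DecidableEq V], ∀ (U W : Finset V) (G' : Finset (V × V)),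
      Disjoint U W → U.card = m → W.card = m →
      (∀ e ∈ G', e.1 ∈ U ∧ e.2 ∈ W) →
      (∀ u ∈ U, (1 - μ - Real.sqrt ε) * m ≤ (outdegD G' u : ℝ) ∧
        (outdegD G' u : ℝ) ≤ (1 - μ + Real.sqrt ε) * m) →
      (∀ w ∈ W, (1 - μ - Real.sqrt ε) * m ≤ (indegD G' w : ℝ) ∧
        (indegD G' w : ℝ) ≤ (1 - μ + Real.sqrt ε) * m) →
      ∀ s₀ : ℕ, (s₀ : ℝ) ≤ ℓ * m / k →
      ∃ (N : ℕ) (F : Fin N → Finset (V × V)),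
        (1 - μ - ρ) * m - s₀ ≤ (N : ℝ) ∧
        (∀ j, F j ⊆ G' ∧
          (∀ u ∈ U, outdegD (F j) u = 1) ∧ (∀ w ∈ W, indegD (F j) w = 1)) ∧
        (∀ j j', j ≠ j' → Disjoint (F j) (F j')) := by
  refine ⟨1/100, by norm_num, ?_⟩
  intro ρ hρ hρ0 ℓ _
  refine ⟨(ρ/4)^2, by positivity, ?_⟩
  intro ε hε hε0 k _ _
  have hq : 0 < Real.sqrt ε := Real.sqrt_pos.mpr hε
  have hq2 : Real.sqrt ε ≤ ρ / 4 := by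
    rw [Real.sqrt_le_left (by positivity)]; exact hε0
  generalize Real.sqrt ε = q at *
  refine ⟨⌈1/q⌉₊, ?_⟩
  intro m hm μ hμ0 hμ V _ U W G' _ hU hW hG ho hi s₀ _
  have hmq : 1 ≤ q * (m : ℝ) := by
    have h : 1 / q ≤ (m : ℝ) := (Nat.le_ceil _).trans (by exact_mod_cast hm)
    rw [div_le_iff₀ hq] at h
    linarith
  have hm0 : (0 : ℝ) ≤ m := Nat.cast_nonneg m
  set r := ⌈(1 - μ - ρ) * (m : ℝ)⌉₊ with hr
  have hr1 : (1 - μ - ρ) * (m : ℝ) ≤ r := Nat.le_ceil _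
  have hr2 : (r : ℝ) < (1 - μ - ρ) * (m : ℝ) + 1 :=
    Nat.ceil_lt_add_one (mul_nonneg (by linarith) hm0)
  obtain ⟨F, hF, hFo, hFi⟩ := factor U W G' m r hU hW hG (by
    intro S hS T hT
    have hSc : (S.card : ℝ) ≤ m := by rw [← hU]; exact_mod_cast Finset.card_le_card hS
    have hTc : (T.card : ℝ) ≤ m := by rw [← hW]; exact_mod_cast Finset.card_le_card hT
    have hT' : ((W \ T).card : ℝ) = m - T.card := by
      have : (W \ T).card + T.card = m := by
        rw [Finset.card_sdiff_add_card_eq_card hT, hW]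
      rw [← this]; push_cast; ring
    have hS' : ((U \ S).card : ℝ) = m - S.card := by
      have : (U \ S).card + S.card = m := by
        rw [Finset.card_sdiff_add_card_eq_card hS, hU]
      rw [← this]; push_cast; ring
    have a1 : (S.card : ℝ) * ((1 - μ - q) * m) ≤ eBetw G' S T + eBetw G' S (W \ T) := by
      have h := out_split U W G' hG S T
      have h' : (∑ u ∈ S, (outdegD G' u : ℝ)) = eBetw G' S T + eBetw G' S (W \ T) := by
        exact_mod_cast h
      rw [← h', ← nsmul_eq_mul]
      exact Finset.card_nsmul_le_sum _ _ _ fun u hu => (ho u (hS hu)).1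
    have a2 : (T.card : ℝ) * ((1 - μ - q) * m) ≤ eBetw G' S T + eBetw G' (U \ S) T := by
      have h := in_split U W G' hG S T
      have h' : (∑ u ∈ T, (indegD G' u : ℝ)) = eBetw G' S T + eBetw G' (U \ S) T := by
        exact_mod_cast h
      rw [← h', ← nsmul_eq_mul]
      exact Finset.card_nsmul_le_sum _ _ _ fun u hu => (hi u (hT hu)).1
    have a3 : (eBetw G' S (W \ T) : ℝ) ≤ S.card * (m - T.card) := by
      rw [← hT']; exact_mod_cast eBetw_le_mul _ _ _
    have a4 : (eBetw G' (U \ S) T : ℝ) ≤ T.card * (m - S.card) := by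
      rw [← hS', mul_comm]; exact_mod_cast eBetw_le_mul _ _ _
    have a5 : (eBetw G' S (W \ T) : ℝ) ≤ ((1 - μ + q) * m) * (m - T.card) := by
      rw [← hT', mul_comm, ← nsmul_eq_mul]
      refine le_trans (b := ∑ u ∈ W \ T, (indegD G' u : ℝ)) ?_ ?_
      · exact_mod_cast eBetw_le_in G' S (W \ T)
      · exact Finset.sum_le_card_nsmul _ _ _ fun u hu => (hi u (Finset.mem_sdiff.mp hu).1).2
    have := key_ineq m r ((1 - μ - q) * m) ((1 - μ + q) * m) S.card T.card (eBetw G' S T)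
      (Nat.cast_nonneg _) hSc hTc (Nat.cast_nonneg _) (Nat.cast_nonneg _)
      (by linarith) (by linarith) (by linarith) (Nat.cast_nonneg _)
      (by nlinarith) (by nlinarith) (by nlinarith)
    exact_mod_cast this)
  obtain ⟨M, hM, hd⟩ := decomp U W m hU hW r F (fun e he => hG e (hF he)) hFo hFi
  refine ⟨r, M, ?_, fun j => ⟨(hM j).1.trans hF, (hM j).2⟩, hd⟩
  have : (0 : ℝ) ≤ s₀ := Nat.cast_nonneg _
  linarith
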